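/- arXiv:1109.3771 — 2 statements merged into one kernel-verified Lean document; each statement's English description precedes it below -/
import Mathlib

section
/- Let R be an augmented Noetherian semiperfect algebra with Jacobson radical J and let ξ : 0 → K → M → N → 0 be a short exact sequence of finitely generated R-modules for which the minimal Horseshoe Lemma holds. Suppose moreover that for every i ≥ 0 the induced embedding of syzygies Ω^i(K) ↪ Ω^i(M) (coming from the minimal Horseshoe Lemma diagram) satisfies J²·Ω^i(K) = Ω^i(K) ∩ J²·Ω^i(M). If K and M are quasi-Koszul modules, then N is a quasi-Koszul module. -/
/-- `jSMul I K` is the submodule `I·K` generated by the products `r • k`,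
`r ∈ I`, `k ∈ K`. -/
def jSMul {R : Type} [Ring R] {M : Type} [AddCommGroup M] [Module R M]
    (I : Ideal R) (K : Submodule R M) : Submodule R M :=
  Submodule.span R {x : M | ∃ r ∈ I, ∃ k ∈ K, x = r • k}

/-- `jPowSMul I n K` is the submodule `Iⁿ·K`. -/
def jPowSMul {R : Type} [Ring R] {M : Type} [AddCommGroup M] [Module R M]
    (I : Ideal R) : ℕ → Submodule R M → Submodule R M
  | 0, K => K
  | n + 1, K => jSMul I (jPowSMul I n K)

/-- The Jacobson radical of a ring. -/
abbrev jacobsonRad (R : Type) [Ring R] : Ideal R := Ideal.jacobson (⊥ : Ideal R)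

/-- A minimal projective resolution `⋯ → P₁ → P₀ → X → 0`. -/
structure MinProjRes (R : Type) [Ring R] (J : Ideal R)
    (X : Type) [AddCommGroup X] [Module R X] where
  obj : ℕ → Type
  [addcomm : ∀ n, AddCommGroup (obj n)]
  [mod : ∀ n, Module R (obj n)]
  proj : ∀ n, Module.Projective R (obj n)
  fin : ∀ n, Module.Finite R (obj n)
  d : ∀ n, obj (n + 1) →ₗ[R] obj n
  aug : obj 0 →ₗ[R] X
  aug_surj : Function.Surjective aug
  exact0 : LinearMap.range (d 0) = LinearMap.ker aug
  exact : ∀ n, LinearMap.range (d (n + 1)) = LinearMap.ker (d n)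
  minimal0 : LinearMap.ker aug ≤ jSMul J ⊤
  minimal : ∀ n, LinearMap.ker (d n) ≤ jSMul J ⊤

attribute [instance] MinProjRes.addcomm MinProjRes.mod

/-- The syzygies of a minimal projective resolution: `P.syz n ⊆ Pₙ`
is the `(n+1)`-st syzygy `Ω^{n+1}(X) = ker dₙ`. -/
def MinProjRes.syz {R : Type} [Ring R] {J : Ideal R}
    {X : Type} [AddCommGroup X] [Module R X]
    (P : MinProjRes R J X) : ∀ n, Submodule R (P.obj n)
  | 0 => LinearMap.ker P.aug
  | n + 1 => LinearMap.ker (P.d n)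

/-- A projective cover of a finitely generated module. -/
structure ProjCover (R : Type) [Ring R] (J : Ideal R)
    (X : Type) [AddCommGroup X] [Module R X] where
  P : Type
  [addcomm : AddCommGroup P]
  [mod : Module R P]
  p : P →ₗ[R] X
  proj : Module.Projective R P
  fin : Module.Finite R P
  surj : Function.Surjective p
  ker_le : LinearMap.ker p ≤ jSMul J ⊤

attribute [instance] ProjCover.addcomm ProjCover.mod

/-- `R` is semiperfect: every finitely generated module has a projective cover. -/
def Semiperfect (R : Type) [Ring R] : Prop :=
  ∀ (X : Type) [AddCommGroup X] [Module R X], Module.Finite R X →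
    Nonempty (ProjCover R (jacobsonRad R) X)

/-- The minimal Horseshoe Lemma holds for the short exact sequence
`0 → K →f→ M →g→ N → 0`. -/
def MinimalHorseshoe {R : Type} [Ring R] (J : Ideal R)
    {K M N : Type} [AddCommGroup K] [Module R K] [AddCommGroup M] [Module R M]
    [AddCommGroup N] [Module R N] (f : K →ₗ[R] M) (g : M →ₗ[R] N) : Prop :=
  ∃ (P : MinProjRes R J K) (L : MinProjRes R J M) (Q : MinProjRes R J N)
    (φ : ∀ n, P.obj n →ₗ[R] L.obj n) (ψ : ∀ n, L.obj n →ₗ[R] Q.obj n),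
    L.aug ∘ₗ φ 0 = f ∘ₗ P.aug ∧
    Q.aug ∘ₗ ψ 0 = g ∘ₗ L.aug ∧
    (∀ n, L.d n ∘ₗ φ (n + 1) = φ n ∘ₗ P.d n) ∧
    (∀ n, Q.d n ∘ₗ ψ (n + 1) = ψ n ∘ₗ L.d n) ∧
    (∀ n, Function.Injective (φ n)) ∧
    (∀ n, Function.Surjective (ψ n)) ∧
    (∀ n, LinearMap.ker (ψ n) = LinearMap.range (φ n))

/-- `X` is a quasi-`δ`-Koszul module. -/
def IsQuasiDeltaKoszul {R : Type} [Ring R] (J : Ideal R) (δ : ℕ → ℕ)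
    (X : Type) [AddCommGroup X] [Module R X] : Prop :=
  ∃ P : MinProjRes R J X, ∀ n,
    P.syz n ≤ jPowSMul J (δ (n + 1) - δ n) ⊤ ∧
    jSMul J (P.syz n) = P.syz n ⊓ jPowSMul J (δ (n + 1) - δ n + 1) ⊤

/-- `X` is a quasi-Koszul module. -/
def IsQuasiKoszul {R : Type} [Ring R] (J : Ideal R)
    (X : Type) [AddCommGroup X] [Module R X] : Prop :=
  ∃ P : MinProjRes R J X, ∀ n,
    jSMul J (P.syz n) = P.syz n ⊓ jPowSMul J 2 ⊤
section Auxiliary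

variable {R : Type} [Ring R] {J : Ideal R}
  {A B C P L Q : Type} [AddCommGroup A] [Module R A] [AddCommGroup B] [Module R B]
  [AddCommGroup C] [Module R C] [AddCommGroup P] [Module R P] [AddCommGroup L] [Module R L]
  [AddCommGroup Q] [Module R Q]

lemma jSMul_mono {S T : Submodule R A} (h : S ≤ T) : jSMul J S ≤ jSMul J T :=
  Submodule.span_mono fun _ ⟨r, hr, k, hk, e⟩ => ⟨r, hr, k, h hk, e⟩

lemma map_jSMul (f : A →ₗ[R] B) (S : Submodule R A) :
    Submodule.map f (jSMul J S) = jSMul J (Submodule.map f S) := by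
  rw [jSMul, jSMul, Submodule.map_span]
  congr 1
  ext x
  constructor
  · rintro ⟨_, ⟨r, hr, k, hk, rfl⟩, rfl⟩
    exact ⟨r, hr, f k, Submodule.mem_map_of_mem hk, map_smul f r k⟩
  · rintro ⟨r, hr, _, ⟨k, hk, rfl⟩, rfl⟩
    exact ⟨r • k, ⟨r, hr, k, hk, rfl⟩, map_smul f r k⟩

lemma map_jPowSMul (f : A →ₗ[R] B) (n : ℕ) (S : Submodule R A) :
    Submodule.map f (jPowSMul J n S) = jPowSMul J n (Submodule.map f S) := by
  induction n with
  | zero => rfl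
  | succ n ih => rw [jPowSMul, jPowSMul, map_jSMul, ih]

lemma map_jPowSMul_top (f : A →ₗ[R] B) (hf : Function.Surjective f) (n : ℕ) :
    Submodule.map f (jPowSMul J n ⊤) = jPowSMul J n ⊤ := by
  rw [map_jPowSMul, Submodule.map_top, LinearMap.range_eq_top.mpr hf]

/-- Nakayama's lemma: `J·A` is superfluous in a finitely generated module `A`. -/
lemma eq_top_of_sup_jSMul_eq_top [Module.Finite R A] (hJ : J = jacobsonRad R)
    {S : Submodule R A} (h : S ⊔ jSMul J ⊤ = ⊤) : S = ⊤ := by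
  rcases eq_top_or_exists_le_coatom S with hS | ⟨m, hm, hSm⟩
  · exact hS
  refine absurd (top_le_iff.mp (h ▸ sup_le hSm ?_)) hm.1
  have hle : jSMul J (⊤ : Submodule R A) ≤ Ring.jacobson R • ⊤ := by
    rw [jSMul, Submodule.span_le]
    rintro _ ⟨r, hr, k, hk, rfl⟩
    rw [hJ, jacobsonRad, Ideal.jacobson_bot] at hr
    exact Submodule.smul_mem_smul hr hk
  exact (hle.trans (Ring.jacobson_smul_top_le R A)).trans (sInf_le hm)

lemma surjective_of_range_le_of_ker_le [Module.Finite R L] (hJ : J = jacobsonRad R)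
    (b : L →ₗ[R] B) (hb : LinearMap.ker b ≤ jSMul J ⊤) (E : P →ₗ[R] L)
    (hE : LinearMap.range b ≤ LinearMap.range (b ∘ₗ E)) : Function.Surjective E := by
  rw [← LinearMap.range_eq_top]
  refine eq_top_of_sup_jSMul_eq_top hJ (top_le_iff.mp fun x _ => ?_)
  obtain ⟨y, hy⟩ := hE ⟨x, rfl⟩
  have hx : x - E y ∈ jSMul J (⊤ : Submodule R L) :=
    hb (by rw [LinearMap.mem_ker, map_sub, sub_eq_zero, ← hy, LinearMap.comp_apply])
  simpa using Submodule.add_mem_sup (LinearMap.mem_range_self E y) hx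

/-- Projective covers are unique up to isomorphism: an isomorphism between the images of two
minimal maps from finitely generated projective modules lifts to their sources. -/
lemma exists_equiv_map_ker_eq [Module.Finite R P] [Module.Finite R L]
    [Module.Projective R P] [Module.Projective R L] (hJ : J = jacobsonRad R)
    (a : P →ₗ[R] A) (b : L →ₗ[R] B) (ha : LinearMap.ker a ≤ jSMul J ⊤)
    (hb : LinearMap.ker b ≤ jSMul J ⊤) (e : A ≃ₗ[R] B)
    (he : Submodule.map (e : A →ₗ[R] B) (LinearMap.range a) = LinearMap.range b) :
    ∃ E : P ≃ₗ[R] L,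
      Submodule.map (E : P →ₗ[R] L) (LinearMap.ker a) = LinearMap.ker b := by
  have hmem (x : P) : e (a x) ∈ LinearMap.range b :=
    he ▸ Submodule.mem_map_of_mem (f := (e : A →ₗ[R] B)) (LinearMap.mem_range_self a x)
  obtain ⟨E, hE⟩ := Module.projective_lifting_property b.rangeRestrict
    (((e : A →ₗ[R] B) ∘ₗ a).codRestrict _ hmem) b.surjective_rangeRestrict
  have hE' (x : P) : b (E x) = e (a x) := congrArg Subtype.val (LinearMap.congr_fun hE x)
  have hsurj : Function.Surjective E := by
    refine surjective_of_range_le_of_ker_le hJ b hb E ?_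
    rw [← he]
    rintro _ ⟨_, ⟨x, rfl⟩, rfl⟩
    exact ⟨x, hE' x⟩
  obtain ⟨s, hs⟩ := Module.projective_lifting_property E LinearMap.id hsurj
  have hs' (x : L) : E (s x) = x := LinearMap.congr_fun hs x
  have hssurj : Function.Surjective s := by
    refine surjective_of_range_le_of_ker_le hJ a ha s ?_
    rintro _ ⟨x, rfl⟩
    refine ⟨E x, e.injective ?_⟩
    rw [LinearMap.comp_apply, ← hE', ← hE', hs']
  have hinj : Function.Injective E := by
    intro x y hxy
    obtain ⟨x, rfl⟩ := hssurj x
    obtain ⟨y, rfl⟩ := hssurj y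
    rw [hs', hs'] at hxy
    rw [hxy]
  refine ⟨LinearEquiv.ofBijective E ⟨hinj, hsurj⟩, ?_⟩
  ext y
  constructor
  · rintro ⟨x, hx, rfl⟩
    have hx' : a x = 0 := hx
    change b (E x) = 0
    rw [hE', hx', map_zero]
  · intro hy
    obtain ⟨x, rfl⟩ := hsurj y
    have hy' : b (E x) = 0 := hy
    refine ⟨x, ?_, rfl⟩
    change a x = 0
    rwa [hE', e.map_eq_zero_iff] at hy'

lemma MinProjRes.syz_le_jSMul {X : Type} [AddCommGroup X] [Module R X]
    (S : MinProjRes R J X) : ∀ n, S.syz n ≤ jSMul J ⊤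
  | 0 => S.minimal0
  | n + 1 => S.minimal n

lemma MinProjRes.range_d {X : Type} [AddCommGroup X] [Module R X]
    (S : MinProjRes R J X) : ∀ n, LinearMap.range (S.d n) = S.syz n
  | 0 => S.exact0
  | n + 1 => S.exact n

lemma MinProjRes.exists_equiv_map_syz_eq {X : Type} [AddCommGroup X] [Module R X]
    (hJ : J = jacobsonRad R) (S T : MinProjRes R J X) (n : ℕ) :
    ∃ E : S.obj n ≃ₗ[R] T.obj n,
      Submodule.map (E : S.obj n →ₗ[R] T.obj n) (S.syz n) = T.syz n := by
  have := S.fin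
  have := T.fin
  have := S.proj
  have := T.proj
  induction n with
  | zero =>
    refine exists_equiv_map_ker_eq hJ S.aug T.aug S.minimal0 T.minimal0
      (LinearEquiv.refl R X) ?_
    rw [LinearMap.range_eq_top.mpr S.aug_surj, LinearMap.range_eq_top.mpr T.aug_surj]
    exact Submodule.map_id _
  | succ n ih =>
    obtain ⟨e, he⟩ := ih
    refine exists_equiv_map_ker_eq hJ (S.d n) (T.d n) (S.minimal n) (T.minimal n) e ?_
    rw [S.range_d, T.range_d, he]

/-- Quasi-Koszulness can be tested on any minimal projective resolution. -/
lemma IsQuasiKoszul.jSMul_syz {X : Type} [AddCommGroup X] [Module R X]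
    (hJ : J = jacobsonRad R) (hX : IsQuasiKoszul J X) (T : MinProjRes R J X) (n : ℕ) :
    jSMul J (T.syz n) = T.syz n ⊓ jPowSMul J 2 ⊤ := by
  obtain ⟨S, hS⟩ := hX
  obtain ⟨E, hE⟩ := MinProjRes.exists_equiv_map_syz_eq hJ S T n
  have h := congrArg (Submodule.map (E : S.obj n →ₗ[R] T.obj n)) (hS n)
  rwa [map_jSMul, Submodule.map_inf _ E.injective, hE, map_jPowSMul_top _ E.surjective] at h

/-- One degree of the argument: the rows are short exact and the columns are minimal covers
of syzygies. -/
lemma jSMul_ker_eq_of_horseshoe (a : P →ₗ[R] A) (b : L →ₗ[R] B) (c : Q →ₗ[R] C)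
    (φ : P →ₗ[R] L) (ψ : L →ₗ[R] Q) (α : A →ₗ[R] B) (β : B →ₗ[R] C)
    (hφ : b ∘ₗ φ = α ∘ₗ a) (hψ : c ∘ₗ ψ = β ∘ₗ b) (hsurj : Function.Surjective ψ)
    (hzero : ψ ∘ₗ φ = 0)
    (hexact : ∀ u ∈ LinearMap.range b, β u = 0 → u ∈ Submodule.map α (LinearMap.range a))
    (hsq : Submodule.map α (jPowSMul J 2 (LinearMap.range a)) =
      Submodule.map α (LinearMap.range a) ⊓ jPowSMul J 2 (LinearMap.range b))
    (hc : LinearMap.ker c ≤ jSMul J ⊤)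
    (hb : jSMul J (LinearMap.ker b) = LinearMap.ker b ⊓ jPowSMul J 2 ⊤) :
    jSMul J (LinearMap.ker c) = LinearMap.ker c ⊓ jPowSMul J 2 ⊤ := by
  refine le_antisymm (le_inf ?_ (jSMul_mono hc)) ?_
  · rw [jSMul, Submodule.span_le]
    rintro _ ⟨r, -, x, hx, rfl⟩
    exact Submodule.smul_mem _ r hx
  rintro x ⟨hx, hx2⟩
  rw [SetLike.mem_coe, ← map_jPowSMul_top ψ hsurj] at hx2
  obtain ⟨y, hy, rfl⟩ := hx2
  have hβ : β (b y) = 0 := (LinearMap.congr_fun hψ y).symm.trans hx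
  have hby : b y ∈ jPowSMul J 2 (LinearMap.range b) := by
    rw [← Submodule.map_top, ← map_jPowSMul]
    exact Submodule.mem_map_of_mem hy
  have hmem : b y ∈ Submodule.map α (jPowSMul J 2 (LinearMap.range a)) :=
    hsq ▸ ⟨hexact _ (LinearMap.mem_range_self b y) hβ, hby⟩
  rw [← Submodule.map_top, ← map_jPowSMul] at hmem
  obtain ⟨_, ⟨z, hz, rfl⟩, hzy⟩ := hmem
  have hφz : φ z ∈ jPowSMul J 2 (⊤ : Submodule R L) := by
    have h : φ z ∈ Submodule.map φ (jPowSMul J 2 ⊤) := Submodule.mem_map_of_mem hz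
    rw [map_jPowSMul] at h
    exact jSMul_mono (jSMul_mono le_top) h
  have hker : y - φ z ∈ LinearMap.ker b := by
    rw [LinearMap.mem_ker, map_sub, sub_eq_zero, ← hzy]
    exact (LinearMap.congr_fun hφ z).symm
  have hsub : y - φ z ∈ jSMul J (LinearMap.ker b) :=
    hb ▸ ⟨hker, Submodule.sub_mem _ hy hφz⟩
  have hxy : ψ (y - φ z) = ψ y := by
    rw [map_sub, show ψ (φ z) = 0 from LinearMap.congr_fun hzero z, sub_zero]
  have himage : ψ (y - φ z) ∈ Submodule.map ψ (jSMul J (LinearMap.ker b)) :=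
    Submodule.mem_map_of_mem hsub
  rw [hxy, map_jSMul] at himage
  refine jSMul_mono ?_ himage
  rintro _ ⟨w, hw, rfl⟩
  have hw' : b w = 0 := hw
  have hcw : c (ψ w) = β (b w) := LinearMap.congr_fun hψ w
  rw [LinearMap.mem_ker, hcw, hw', map_zero]

/-- Exactness in the middle of the rows passes to the syzygies. -/
lemma mem_map_ker_of_exact (a : P →ₗ[R] A) (b : L →ₗ[R] B) (φ : P →ₗ[R] L) (ψ : L →ₗ[R] Q)
    (α : A →ₗ[R] B) (hφ : b ∘ₗ φ = α ∘ₗ a) (hα : Function.Injective α)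
    (hker : LinearMap.ker ψ = LinearMap.range φ) {u : L} (hu : u ∈ LinearMap.ker b)
    (hψu : ψ u = 0) : u ∈ Submodule.map φ (LinearMap.ker a) := by
  obtain ⟨w, rfl⟩ : u ∈ LinearMap.range φ := hker ▸ hψu
  refine ⟨w, hα ?_, rfl⟩
  rw [map_zero, ← LinearMap.comp_apply, ← hφ]
  exact hu

end Auxiliary

/-- Theorem D(2): if the minimal Horseshoe Lemma holds for
`0 → K → M → N → 0` via a diagram whose syzygy embeddings satisfy
`J²·Ω^i(K) = Ω^i(K) ∩ J²·Ω^i(M)` for all `i ≥ 0`, and `K`, `M` are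
quasi-Koszul, then `N` is quasi-Koszul. -/
theorem quasiKoszul_cokernel_of_minimalHorseshoe
    {k : Type} [Field k] {R : Type} [Ring R] [Algebra k R] (ε : R →ₐ[k] k)
    [IsNoetherianRing R] (hsp : Semiperfect R) (J : Ideal R)
    (hJ : J = jacobsonRad R)
    {K M N : Type} [AddCommGroup K] [Module R K] [AddCommGroup M] [Module R M]
    [AddCommGroup N] [Module R N]
    [Module.Finite R K] [Module.Finite R M] [Module.Finite R N]
    (f : K →ₗ[R] M) (g : M →ₗ[R] N)
    (hf : Function.Injective f) (hg : Function.Surjective g)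
    (hfg : LinearMap.range f = LinearMap.ker g)
    (hMHL : ∃ (P : MinProjRes R J K) (L : MinProjRes R J M)
      (Q : MinProjRes R J N)
      (φ : ∀ n, P.obj n →ₗ[R] L.obj n) (ψ : ∀ n, L.obj n →ₗ[R] Q.obj n),
      L.aug ∘ₗ φ 0 = f ∘ₗ P.aug ∧
      Q.aug ∘ₗ ψ 0 = g ∘ₗ L.aug ∧
      (∀ n, L.d n ∘ₗ φ (n + 1) = φ n ∘ₗ P.d n) ∧
      (∀ n, Q.d n ∘ₗ ψ (n + 1) = ψ n ∘ₗ L.d n) ∧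
      (∀ n, Function.Injective (φ n)) ∧
      (∀ n, Function.Surjective (ψ n)) ∧
      (∀ n, LinearMap.ker (ψ n) = LinearMap.range (φ n)) ∧
      -- the extra hypothesis `J²·Ω^i(K) = Ω^i(K) ∩ J²·Ω^i(M)` for all `i ≥ 0`:
      -- the case `i = 0`, via the embedding `f : Ω⁰(K) = K ↪ M = Ω⁰(M)`
      Submodule.map f (jPowSMul J 2 (⊤ : Submodule R K)) =
        LinearMap.range f ⊓ jPowSMul J 2 (⊤ : Submodule R M) ∧
      -- the cases `i ≥ 1`, via `Ω^{i+1}(K) = P.syz i ↪ L.syz i = Ω^{i+1}(M)`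
      ∀ i, Submodule.map (φ i) (jPowSMul J 2 (P.syz i)) =
        Submodule.map (φ i) (P.syz i) ⊓ jPowSMul J 2 (L.syz i))
    (hK : IsQuasiKoszul J K) (hM : IsQuasiKoszul J M) :
    IsQuasiKoszul J N := by
  obtain ⟨P, L, Q, φ, ψ, hφ0, hψ0, hφ, hψ, hφi, hψs, hker, hsq0, hsq⟩ := hMHL
  have hL := hM.jSMul_syz hJ L
  have hzero (n : ℕ) : ψ n ∘ₗ φ n = 0 := LinearMap.range_le_ker_iff.mp (hker n).ge
  refine ⟨Q, fun n => ?_⟩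
  cases n with
  | zero =>
    refine jSMul_ker_eq_of_horseshoe P.aug L.aug Q.aug (φ 0) (ψ 0) f g hφ0 hψ0 (hψs 0)
      (hzero 0) ?_ ?_ Q.minimal0 (hL 0)
    · intro u _ hu
      rw [LinearMap.range_eq_top.mpr P.aug_surj, Submodule.map_top, hfg]
      exact hu
    · rw [LinearMap.range_eq_top.mpr P.aug_surj, LinearMap.range_eq_top.mpr L.aug_surj,
        hsq0, Submodule.map_top]
  | succ n =>
    refine jSMul_ker_eq_of_horseshoe (P.d n) (L.d n) (Q.d n) (φ (n + 1)) (ψ (n + 1)) (φ n)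
      (ψ n) (hφ n) (hψ n) (hψs _) (hzero _) ?_ ?_ (Q.minimal n) (hL (n + 1))
    · intro u hu hψu
      rw [L.range_d] at hu
      rw [P.range_d]
      cases n with
      | zero => exact mem_map_ker_of_exact _ _ _ _ f hφ0 hf (hker 0) hu hψu
      | succ n => exact mem_map_ker_of_exact _ _ _ _ _ (hφ n) (hφi n) (hker _) hu hψu
    · rw [P.range_d, L.range_d, hsq]
end

section
/- Let A be a standard graded k-algebra with graded Jacobson radical J = ⊕_{i≥1} A_i, and let ⋯ → P_n →d_n→ ⋯ → P₁ →d₁→ P₀ →d₀→ A₀ → 0 be a minimal graded projective resolution of the trivial A-module A₀. Then the following are equivalent for a strictly increasing set function δ : ℕ → ℕ with δ(0) = 0: (1) A is a δ-Koszul algebra, i.e. each P_n is generated in degree δ(n); (2) for all n ≥ 0, ker d_n ⊆ J^{δ(n+1)−δ(n)}·P_n and J·ker d_n = ker d_n ∩ J^{δ(n+1)−δ(n)+1}·P_n. -/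
/-- The graded Jacobson radical `J = ⊕_{i ≥ 1} A_i` of a graded algebra. -/
def gradedRad {k : Type} [Field k] {A : Type} [Ring A] [Algebra k A]
    (𝒜 : ℕ → Submodule k A) : Ideal A :=
  Submodule.span A (⋃ i ∈ Set.Ici 1, (𝒜 i : Set A))

/-- `A`, graded by `𝒜`, is a standard graded `k`-algebra: `A₀` is a finite
product of copies of `k`, `A_i·A_j = A_{i+j}` and each `A_i` is
finite-dimensional over `k`. -/
def IsStandardGraded (k : Type) [Field k] (A : Type) [Ring A] [Algebra k A]
    (𝒜 : ℕ → Submodule k A) [GradedAlgebra 𝒜] : Prop :=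
  (∃ m : ℕ, Nonempty ((𝒜 0) ≃ₐ[k] (Fin m → k))) ∧
  (∀ i j, 𝒜 i * 𝒜 j = 𝒜 (i + j)) ∧
  (∀ i, FiniteDimensional k (𝒜 i))

/-- A minimal graded projective resolution `⋯ → P₁ → P₀ → X → 0` of a graded
module `X` (graded by `𝒳`) over a graded algebra `(A, 𝒜)`: each `Pₙ` is a
finitely generated graded projective `A`-module, all the maps are `A`-linear
of degree zero, the sequence is exact, and `ker dₙ ⊆ J·Pₙ` for all `n`, where
`J = ⊕_{i≥1} A_i`. -/
structure MinGradedProjRes (k : Type) [Field k] (A : Type) [Ring A]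
    [Algebra k A] (𝒜 : ℕ → Submodule k A)
    (X : Type) [AddCommGroup X] [Module A X] (𝒳 : ℕ → AddSubgroup X) where
  obj : ℕ → Type
  [addcomm : ∀ n, AddCommGroup (obj n)]
  [mod : ∀ n, Module A (obj n)]
  /-- the grading of the `n`-th term -/
  gr : ∀ n, ℕ → AddSubgroup (obj n)
  [decomp : ∀ n, DirectSum.Decomposition (gr n)]
  gsmul : ∀ n, SetLike.GradedSMul 𝒜 (gr n)
  proj : ∀ n, Module.Projective A (obj n)
  fin : ∀ n, Module.Finite A (obj n)
  d : ∀ n, obj (n + 1) →ₗ[A] obj n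
  aug : obj 0 →ₗ[A] X
  d_graded : ∀ n i x, x ∈ gr (n + 1) i → d n x ∈ gr n i
  aug_graded : ∀ i x, x ∈ gr 0 i → aug x ∈ 𝒳 i
  aug_surj : Function.Surjective aug
  exact0 : LinearMap.range (d 0) = LinearMap.ker aug
  exact : ∀ n, LinearMap.range (d (n + 1)) = LinearMap.ker (d n)
  minimal0 : LinearMap.ker aug ≤ jSMul (gradedRad 𝒜) ⊤
  minimal : ∀ n, LinearMap.ker (d n) ≤ jSMul (gradedRad 𝒜) ⊤

attribute [instance] MinGradedProjRes.addcomm MinGradedProjRes.mod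
  MinGradedProjRes.decomp

/-- The syzygies of a minimal graded projective resolution:
`P.syz n ⊆ Pₙ` is `Ω^{n+1}(X) = ker dₙ`. -/
def MinGradedProjRes.syz {k : Type} [Field k] {A : Type} [Ring A]
    [Algebra k A] {𝒜 : ℕ → Submodule k A}
    {X : Type} [AddCommGroup X] [Module A X] {𝒳 : ℕ → AddSubgroup X}
    (P : MinGradedProjRes k A 𝒜 X 𝒳) : ∀ n, Submodule A (P.obj n)
  | 0 => LinearMap.ker P.aug
  | n + 1 => LinearMap.ker (P.d n)

/-- The `n`-th term of the resolution is generated in degree `e`. -/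
def MinGradedProjRes.GenInDeg {k : Type} [Field k] {A : Type} [Ring A]
    [Algebra k A] {𝒜 : ℕ → Submodule k A}
    {X : Type} [AddCommGroup X] [Module A X] {𝒳 : ℕ → AddSubgroup X}
    (P : MinGradedProjRes k A 𝒜 X 𝒳) (n e : ℕ) : Prop :=
  Submodule.span A ((P.gr n e : Set (P.obj n))) = ⊤

theorem mem_gradedRad_of_mem {k A : Type} [Field k] [Ring A] [Algebra k A]
    (𝒜 : ℕ → Submodule k A) {i : ℕ} (hi : 1 ≤ i) {a : A} (ha : a ∈ 𝒜 i) :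
    a ∈ gradedRad 𝒜 :=
  Submodule.subset_span (Set.mem_biUnion (Set.mem_Ici.2 hi) ha)

theorem smul_mem_jSMul {R M : Type} [Ring R] [AddCommGroup M] [Module R M] {I : Ideal R}
    {K : Submodule R M} {r : R} (hr : r ∈ I) {x : M} (hx : x ∈ K) : r • x ∈ jSMul I K :=
  Submodule.subset_span ⟨r, hr, x, hx, rfl⟩

theorem jSMul_le {R M : Type} [Ring R] [AddCommGroup M] [Module R M] (I : Ideal R)
    (K : Submodule R M) : jSMul I K ≤ K := by
  refine Submodule.span_le.2 ?_
  rintro _ ⟨r, -, x, hx, rfl⟩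
  exact K.smul_mem r hx

theorem map_jSMul_s14 {R M N : Type} [Ring R] [AddCommGroup M] [Module R M] [AddCommGroup N]
    [Module R N] (f : M →ₗ[R] N) (I : Ideal R) (K : Submodule R M) :
    (jSMul I K).map f = jSMul I (K.map f) := by
  rw [jSMul, Submodule.map_span, jSMul]
  congr 1
  ext y
  constructor
  · rintro ⟨_, ⟨r, hr, x, hx, rfl⟩, rfl⟩
    exact ⟨r, hr, f x, Submodule.mem_map_of_mem hx, map_smul f r x⟩
  · rintro ⟨r, hr, _, ⟨x, hx, rfl⟩, rfl⟩
    exact ⟨r • x, ⟨r, hr, x, hx, rfl⟩, map_smul f r x⟩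

section GradedFiltration

open DirectSum

variable {M σ : Type} [AddCommGroup M] [SetLike σ M] [AddSubgroupClass σ M]

/-- The elements of a graded group all of whose components of degree less than `e` vanish. -/
def degGE (gr : ℕ → σ) [Decomposition gr] (e : ℕ) : AddSubgroup M where
  carrier := {x | ∀ i < e, (decompose gr x i : M) = 0}
  zero_mem' := by simp
  add_mem' := by
    intro x y hx hy i hi
    simp [hx i hi, hy i hi]
  neg_mem' := by
    intro x hx i hi
    rw [decompose_neg]
    exact neg_eq_zero.2 (hx i hi)

theorem mem_degGE_of_mem {gr : ℕ → σ} [Decomposition gr] {e i : ℕ} (h : e ≤ i) {x : M}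
    (hx : x ∈ gr i) : x ∈ degGE gr e := fun j hj => by
  rw [decompose_of_mem_ne gr hx (by omega)]

theorem mem_of_mem_degGE {gr : ℕ → σ} [Decomposition gr] {e : ℕ} {x : M}
    (hx : x ∈ degGE gr e) (N : AddSubgroup M)
    (h : ∀ i, e ≤ i → (decompose gr x i : M) ∈ N) : x ∈ N := by
  classical
  rw [← sum_support_decompose gr x]
  refine sum_mem fun i _ => ?_
  by_cases hi : e ≤ i
  · exact h i hi
  · rw [hx i (by omega)]
    exact N.zero_mem

variable {k A : Type} [Field k] [Ring A] [Algebra k A] (𝒜 : ℕ → Submodule k A) [GradedAlgebra 𝒜]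
  [Module A M] (gr : ℕ → σ) [Decomposition gr] [SetLike.GradedSMul 𝒜 gr]

theorem smul_mem_degGE {d e : ℕ} {a : A} {x : M} (ha : a ∈ degGE 𝒜 d) (hx : x ∈ degGE gr e) :
    a • x ∈ degGE gr (d + e) := by
  have h1 : ∀ i, e ≤ i → ∀ y ∈ gr i, a • y ∈ degGE gr (d + e) := by
    intro i hi y hy
    refine mem_of_mem_degGE ha
      ((degGE gr (d + e)).comap (LinearMap.toSpanSingleton A M y).toAddMonoidHom) fun j hj => ?_
    exact mem_degGE_of_mem (i := j + i) (by omega)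
      (SetLike.GradedSMul.smul_mem (SetLike.coe_mem (decompose 𝒜 a j)) hy)
  exact mem_of_mem_degGE hx
    ((degGE gr (d + e)).comap (DistribSMul.toAddMonoidHom M a))
    fun i hi => h1 i hi _ (SetLike.coe_mem _)

/-- `degGE` as a submodule over the graded ring. -/
def degGESubmodule (e : ℕ) : Submodule A M where
  __ := degGE gr e
  smul_mem' := by
    intro a x hx
    have := smul_mem_degGE 𝒜 gr (d := 0) (a := a) (fun i hi => absurd hi (Nat.not_lt_zero i)) hx
    rwa [zero_add] at this

theorem mem_degGESubmodule {e : ℕ} {x : M} : x ∈ degGESubmodule 𝒜 gr e ↔ x ∈ degGE gr e :=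
  Iff.rfl

theorem mem_degGE_of_mem_gradedRad {a : A} (ha : a ∈ gradedRad 𝒜) : a ∈ degGE 𝒜 1 := by
  rw [← mem_degGESubmodule 𝒜 𝒜]
  refine Submodule.span_le.2 ?_ ha
  intro x hx
  simp only [Set.mem_iUnion] at hx
  obtain ⟨i, hi, hx⟩ := hx
  exact mem_degGE_of_mem hi hx

theorem jSMul_le_degGE {K : Submodule A M} {e : ℕ} (hK : K ≤ degGESubmodule 𝒜 gr e) :
    jSMul (gradedRad 𝒜) K ≤ degGESubmodule 𝒜 gr (e + 1) := by
  refine Submodule.span_le.2 ?_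
  rintro _ ⟨r, hr, x, hx, rfl⟩
  rw [add_comm e 1]
  exact smul_mem_degGE 𝒜 gr (mem_degGE_of_mem_gradedRad 𝒜 hr) (hK hx)

/-- Each component of an element of a submodule generated in degree `d` is a sum of products
of ring elements of the complementary degree with generators. -/
theorem decompose_mem_closure_of_mem_span {d : ℕ} {S : Set M} (hS : S ⊆ (gr d : Set M)) {x : M}
    (hx : x ∈ Submodule.span A S) (i : ℕ) :
    (decompose gr x i : M) ∈
      AddSubgroup.closure {y | ∃ j, j + d = i ∧ ∃ a ∈ 𝒜 j, ∃ s ∈ S, y = a • s} := by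
  set C := AddSubgroup.closure {y | ∃ j, j + d = i ∧ ∃ a ∈ 𝒜 j, ∃ s ∈ S, y = a • s}
  let N : AddSubgroup M :=
    { carrier := {y | (decompose gr y i : M) ∈ C}
      zero_mem' := by simp
      add_mem' := by
        intro y z hy hz
        simpa using C.add_mem hy hz
      neg_mem' := by
        intro y hy
        change ((decompose gr (-y) i : gr i) : M) ∈ C
        rw [decompose_neg]
        exact C.neg_mem hy }
  have hx' : x ∈ (Submodule.span A S).toAddSubmonoid := hx
  rw [Submodule.span_eq_closure] at hx'
  refine (AddSubmonoid.closure_le (S := N.toAddSubmonoid)).2 ?_ hx'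
  rintro _ ⟨a, -, s, hs, rfl⟩
  refine mem_of_mem_degGE (gr := 𝒜) (e := 0) (x := a)
    (fun i hi => absurd hi (Nat.not_lt_zero i))
    (N.comap (LinearMap.toSpanSingleton A M s).toAddMonoidHom) fun j _ => ?_
  have hm : (decompose 𝒜 a j : A) • s ∈ gr (j + d) :=
    SetLike.GradedSMul.smul_mem (SetLike.coe_mem (decompose 𝒜 a j)) (hS hs)
  change (decompose gr ((decompose 𝒜 a j : A) • s) i : M) ∈ C
  by_cases h : j + d = i
  · subst h
    rw [decompose_of_mem_same gr hm]
    exact AddSubgroup.subset_closure ⟨j, rfl, _, SetLike.coe_mem _, s, hs, rfl⟩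
  · rw [decompose_of_mem_ne gr hm h]
    exact C.zero_mem

theorem span_le_degGE {d : ℕ} {S : Set M} (hS : S ⊆ (gr d : Set M)) :
    Submodule.span A S ≤ degGESubmodule 𝒜 gr d :=
  Submodule.span_le.2 fun _ hx => mem_degGE_of_mem le_rfl (hS hx)

theorem jSMul_span_eq {d : ℕ} {S : Set M} (hS : S ⊆ (gr d : Set M)) :
    jSMul (gradedRad 𝒜) (Submodule.span A S) =
      Submodule.span A S ⊓ degGESubmodule 𝒜 gr (d + 1) := by
  refine le_antisymm (le_inf (jSMul_le _ _)
    (jSMul_le_degGE 𝒜 gr (span_le_degGE 𝒜 gr hS))) ?_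
  rintro x ⟨hx, hd⟩
  refine mem_of_mem_degGE (gr := gr) (e := d + 1) hd
    (jSMul (gradedRad 𝒜) (Submodule.span A S)).toAddSubgroup fun i hi => ?_
  refine (AddSubgroup.closure_le _).2 ?_ (decompose_mem_closure_of_mem_span 𝒜 gr hS hx i)
  rintro _ ⟨j, hj, a, ha, s, hs, rfl⟩
  exact smul_mem_jSMul (mem_gradedRad_of_mem 𝒜 (by omega) ha) (Submodule.subset_span hs)

theorem jPowSMul_top_eq (hmul : ∀ i j, 𝒜 i * 𝒜 j = 𝒜 (i + j)) {d : ℕ}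
    (hd : Submodule.span A (gr d : Set M) = ⊤) (s : ℕ) :
    jPowSMul (gradedRad 𝒜) s ⊤ = degGESubmodule 𝒜 gr (d + s) := by
  induction s with
  | zero => exact (top_le_iff.1 (hd ▸ span_le_degGE 𝒜 gr subset_rfl)).symm
  | succ s ih =>
    refine le_antisymm (jSMul_le_degGE 𝒜 gr ih.le) fun x hx => ?_
    set Q := jPowSMul (gradedRad 𝒜) (s + 1) (⊤ : Submodule A M)
    refine mem_of_mem_degGE (gr := gr) (e := d + s + 1) hx Q.toAddSubgroup fun i hi => ?_
    refine (AddSubgroup.closure_le _).2 ?_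
      (decompose_mem_closure_of_mem_span 𝒜 gr subset_rfl (hd ▸ Submodule.mem_top : x ∈ _) i)
    rintro _ ⟨j, hj, a, ha, m, hm, rfl⟩
    obtain ⟨l, rfl⟩ : ∃ l, j = 1 + l := ⟨j - 1, by omega⟩
    rw [← hmul] at ha
    change a • m ∈ Q
    induction ha using Submodule.mul_induction_on' with
    | mem_mul_mem b hb c hc =>
      rw [mul_smul]
      refine smul_mem_jSMul (mem_gradedRad_of_mem 𝒜 le_rfl hb) ?_
      rw [ih]
      exact mem_degGE_of_mem (i := l + d) (by omega) (SetLike.GradedSMul.smul_mem hc hm)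
    | add b _ c _ hb hc =>
      rw [add_smul]
      exact Q.add_mem hb hc

/-- Graded Nakayama lemma for a submodule generated in a single degree. -/
theorem span_eq_top_of_sup_jSMul {d : ℕ}
    (h : ⊤ ≤ Submodule.span A (gr d : Set M) ⊔ jSMul (gradedRad 𝒜) ⊤) :
    Submodule.span A (gr d : Set M) = ⊤ := by
  set N := Submodule.span A (gr d : Set M)
  have key : ∀ i, ⊤ ≤ N ⊔ degGESubmodule 𝒜 gr i := by
    intro i
    induction i with
    | zero => exact fun x _ => Submodule.mem_sup_right fun i hi => absurd hi (Nat.not_lt_zero i)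
    | succ i ih =>
      refine h.trans (sup_le le_sup_left (Submodule.span_le.2 ?_))
      rintro _ ⟨r, hr, x, -, rfl⟩
      obtain ⟨n, hn, y, hy, rfl⟩ := Submodule.mem_sup.1 (ih (Submodule.mem_top (x := x)))
      rw [smul_add]
      refine Submodule.add_mem_sup (N.smul_mem r hn) ?_
      rw [add_comm i 1]
      exact smul_mem_degGE 𝒜 gr (mem_degGE_of_mem_gradedRad 𝒜 hr) hy
  refine top_le_iff.1 fun x _ => ?_
  refine mem_of_mem_degGE (gr := gr) (e := 0) (x := x)
    (fun i hi => absurd hi (Nat.not_lt_zero i)) N.toAddSubgroup fun i _ => ?_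
  obtain ⟨n, hn, y, hy, hxy⟩ := Submodule.mem_sup.1 (key (i + 1) (Submodule.mem_top (x := x)))
  rw [← hxy, decompose_add, DirectSum.add_apply, AddMemClass.coe_add, hy i (by omega), add_zero]
  refine (AddSubgroup.closure_le _).2 ?_
    (decompose_mem_closure_of_mem_span 𝒜 gr subset_rfl hn i)
  rintro _ ⟨j, -, a, -, s, hs, rfl⟩
  exact N.smul_mem a (Submodule.subset_span hs)

end GradedFiltration

namespace MinGradedProjRes

open DirectSum

variable {k A : Type} [Field k] [Ring A] [Algebra k A] {𝒜 : ℕ → Submodule k A}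
  {X : Type} [AddCommGroup X] [Module A X] {𝒳 : ℕ → AddSubgroup X}
  (P : MinGradedProjRes k A 𝒜 X 𝒳)

theorem range_d_eq_syz (n : ℕ) : LinearMap.range (P.d n) = P.syz n := by
  cases n with
  | zero => exact P.exact0
  | succ n => exact P.exact n

theorem decompose_d (n : ℕ) (x : P.obj (n + 1)) (i : ℕ) :
    (decompose (P.gr n) (P.d n x) i : P.obj n) = P.d n (decompose (P.gr (n + 1)) x i) := by
  induction x using Decomposition.inductionOn (P.gr (n + 1)) with
  | zero => simp
  | @homogeneous j m =>
    have hm := P.d_graded n j m m.2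
    by_cases h : j = i
    · subst h
      rw [decompose_of_mem_same _ hm, decompose_of_mem_same _ m.2]
    · rw [decompose_of_mem_ne _ hm h, decompose_of_mem_ne _ m.2 h, map_zero]
  | add x y hx hy => simp [hx, hy]

theorem syz_eq_span {n e : ℕ} (h : P.GenInDeg (n + 1) e) :
    P.syz n = Submodule.span A (P.d n '' (P.gr (n + 1) e : Set (P.obj (n + 1)))) := by
  rw [← P.range_d_eq_syz, ← Submodule.map_span, h, Submodule.map_top]

end MinGradedProjRes


/-- Theorem 2.4, (1) ⇔ (2): for a minimal graded projective
resolution of the trivial module `A₀ = A/J` over a standard graded algebra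
`A`, each `Pₙ` is generated in degree `δ(n)` iff for all `n`,
`ker dₙ ⊆ J^{δ(n+1)-δ(n)}·Pₙ` and
`J·ker dₙ = ker dₙ ∩ J^{δ(n+1)-δ(n)+1}·Pₙ`. -/
theorem deltaKoszul_algebra_iff_syzygy_condition
    {k : Type} [Field k] {A : Type} [Ring A] [Algebra k A]
    (𝒜 : ℕ → Submodule k A) [GradedAlgebra 𝒜]
    (hstd : IsStandardGraded k A 𝒜)
    (δ : ℕ → ℕ) (hδ : StrictMono δ) (hδ0 : δ 0 = 0)
    (P : MinGradedProjRes k A 𝒜 (A ⧸ gradedRad 𝒜)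
      (fun i => if i = 0 then ⊤ else ⊥)) :
    (∀ n, P.GenInDeg n (δ n)) ↔
    (∀ n, P.syz n ≤ jPowSMul (gradedRad 𝒜) (δ (n + 1) - δ n) ⊤ ∧
      jSMul (gradedRad 𝒜) (P.syz n) =
        P.syz n ⊓ jPowSMul (gradedRad 𝒜) (δ (n + 1) - δ n + 1) ⊤) := by
  have hgs := P.gsmul
  constructor
  · intro h n
    have hle : δ n + (δ (n + 1) - δ n) = δ (n + 1) := by
      have := hδ (Nat.lt_add_one n)
      omega
    have hS : P.d n '' (P.gr (n + 1) (δ (n + 1)) : Set (P.obj (n + 1))) ⊆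
        (P.gr n (δ (n + 1)) : Set (P.obj n)) := by
      rintro _ ⟨x, hx, rfl⟩
      exact P.d_graded n _ x hx
    rw [jPowSMul_top_eq 𝒜 (P.gr n) hstd.2.1 (h n), jPowSMul_top_eq 𝒜 (P.gr n) hstd.2.1 (h n),
      ← add_assoc, hle, P.syz_eq_span (h (n + 1))]
    exact ⟨span_le_degGE 𝒜 (P.gr n) hS, jSMul_span_eq 𝒜 (P.gr n) hS⟩
  · intro h n
    induction n with
    | zero =>
      rw [hδ0]
      refine span_eq_top_of_sup_jSMul 𝒜 (P.gr 0) fun x _ => ?_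
      rw [← add_sub_cancel (DirectSum.decompose (P.gr 0) x 0 : P.obj 0) x]
      refine Submodule.add_mem_sup (Submodule.subset_span (SetLike.coe_mem _)) (P.minimal0 ?_)
      refine mem_of_mem_degGE (gr := P.gr 0) (e := 1) ?_
        (LinearMap.ker P.aug).toAddSubgroup fun i hi => ?_
      · intro i hi
        obtain rfl : i = 0 := by omega
        simp [DirectSum.decompose_sub]
      · have := P.aug_graded i _ (SetLike.coe_mem (DirectSum.decompose (P.gr 0)
          (x - (DirectSum.decompose (P.gr 0) x 0 : P.obj 0)) i))
        rw [if_neg (by omega)] at this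
        exact this
    | succ n ih =>
      obtain ⟨h1, h2⟩ := h n
      have hle : δ n + (δ (n + 1) - δ n) = δ (n + 1) := by
        have := hδ (Nat.lt_add_one n)
        omega
      rw [jPowSMul_top_eq 𝒜 (P.gr n) hstd.2.1 ih, hle] at h1
      rw [jPowSMul_top_eq 𝒜 (P.gr n) hstd.2.1 ih, ← add_assoc, hle, ← P.range_d_eq_syz,
        ← Submodule.map_top, ← map_jSMul_s14] at h2
      refine span_eq_top_of_sup_jSMul 𝒜 (P.gr (n + 1)) fun x _ => ?_
      set x₀ : P.obj (n + 1) := (DirectSum.decompose (P.gr (n + 1)) x (δ (n + 1)) : P.obj (n + 1))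
        with hx₀
      rw [← add_sub_cancel x₀ x]
      refine Submodule.add_mem_sup (Submodule.subset_span (SetLike.coe_mem _)) ?_
      have hmem : P.d n (x - x₀) ∈ (jSMul (gradedRad 𝒜) ⊤).map (P.d n) := by
        rw [h2]
        refine ⟨Submodule.mem_map_of_mem Submodule.mem_top, fun i hi => ?_⟩
        rcases Nat.lt_succ_iff_lt_or_eq.1 hi with hi | rfl
        · exact h1 (P.range_d_eq_syz n ▸ LinearMap.mem_range_self (P.d n) (x - x₀)) i hi
        · rw [P.decompose_d]
          simp [DirectSum.decompose_sub, hx₀]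
      obtain ⟨y, hy, hyx⟩ := hmem
      rw [← add_sub_cancel y (x - x₀)]
      refine Submodule.add_mem _ hy (P.minimal n ?_)
      rw [LinearMap.mem_ker, map_sub, hyx, sub_self]
end
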